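/- (Normalized Pinsker's Inequality) Let L be a complete leaf set over a finite alphabet Z with branching set B, let P_Z be a probability distribution on Z with P_Z(z) > 0 for all z ∈ Z and induced leaf distribution P_Z^L, and let P_Y be a probability distribution on L with node probabilities Q, branching distributions P_{Y_t}, and P_B(t) := Q(t)/E[ℓ(Y)]. Then D(P_Y ‖ P_Z^L) / E[ℓ(Y)] ≥ (1/(2 ln 2)) · Σ_{t ∈ B} P_B(t) ‖P_{Y_t} − P_Z‖₁² ≥ (1/(2 ln 2)) · (Σ_{t ∈ B} P_B(t) ‖P_{Y_t} − P_Z‖₁)², where terms with Q(t) = 0 are taken to be 0. -/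

import Mathlib

open Finset

noncomputable section

/-- A finite set of nonempty strings over `Z` is a *complete leaf set* if it is
prefix-free and every sufficiently long string over `Z` has exactly one prefix in it
(equivalently, it is the leaf set of a finite rooted tree in which every branching
node has exactly `|Z|` children, one per letter). -/
def IsCompleteLeafSet {Z : Type*} (L : Finset (List Z)) : Prop :=
  (∀ t ∈ L, t ≠ []) ∧
  (∀ s ∈ L, ∀ t ∈ L, s <+: t → s = t) ∧
  (∃ N : ℕ, ∀ s : List Z, N ≤ s.length → ∃! t, t ∈ L ∧ t <+: s)

/-- The branching set: all proper prefixes of leaves, including the root `[]`. -/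
def branchSet {Z : Type*} [DecidableEq Z] (L : Finset (List Z)) : Finset (List Z) :=
  L.biUnion fun t => (Finset.range t.length).image fun i => t.take i

/-- Node probability `Q(t)`: total probability of the leaves having `t` as a prefix. -/
def nodeProb {Z : Type*} [DecidableEq Z] (L : Finset (List Z)) (P : List Z → ℝ)
    (t : List Z) : ℝ :=
  ∑ s ∈ L.filter (fun s => t <+: s), P s

/-- Branching distribution `P_{Y_t}(z) = Q(tz)/Q(t)` (junk value `0` when `Q(t) = 0`,
so that terms with `Q(t) = 0` vanish). -/
def branchDist {Z : Type*} [DecidableEq Z] (L : Finset (List Z)) (P : List Z → ℝ)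
    (t : List Z) (z : Z) : ℝ :=
  nodeProb L P (t ++ [z]) / nodeProb L P t

/-- Expected leaf depth `E[ℓ(Y)]`. -/
def expLen {Z : Type*} (L : Finset (List Z)) (P : List Z → ℝ) : ℝ :=
  ∑ t ∈ L, P t * t.length

/-- Shannon entropy in bits of `P` on the finite set `S` (terms with `P x = 0` vanish). -/
def ent {α : Type*} (S : Finset α) (P : α → ℝ) : ℝ :=
  ∑ x ∈ S, -(P x * Real.logb 2 (P x))

/-- Informational divergence in bits of `P` from `P'` on `S` (terms with `P x = 0` vanish). -/
def kl {α : Type*} (S : Finset α) (P P' : α → ℝ) : ℝ :=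
  ∑ x ∈ S, P x * Real.logb 2 (P x / P' x)

/-- The leaf distribution induced by a memoryless source: `P_Z^L(t) = ∏ i, P_Z(t_i)`. -/
def inducedProb {Z : Type*} (P : Z → ℝ) (t : List Z) : ℝ :=
  (t.map P).prod

/-- `L¹` (total variation) distance between two distributions on a finite alphabet. -/
def l1dist {Z : Type*} [Fintype Z] (P P' : Z → ℝ) : ℝ :=
  ∑ z, |P z - P' z|

/-- The rational lower bound on the logarithm behind Pinsker's inequality. -/
theorem log_lower (x : ℝ) (hx : 0 < x) :
    (x - 1) * (5 * x + 1) / (2 * x * (x + 2)) ≤ Real.log x := by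
  set G : ℝ → ℝ := fun x => Real.log x - (x - 1) * (5 * x + 1) / (2 * x * (x + 2)) with hG
  have hd : ∀ y : ℝ, 0 < y → HasDerivAt G ((y - 1) ^ 3 / (y ^ 2 * (y + 2) ^ 2)) y := by
    intro y hy
    have h1 := Real.hasDerivAt_log hy.ne'
    have h2 : HasDerivAt (fun x : ℝ => (x - 1) * (5 * x + 1))
        (1 * (5 * y + 1) + (y - 1) * (5 * 1)) y :=
      ((hasDerivAt_id y).sub_const 1).mul (((hasDerivAt_id y).const_mul 5).add_const 1)
    have h3 : HasDerivAt (fun x : ℝ => 2 * x * (x + 2))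
        (2 * 1 * (y + 2) + 2 * y * 1) y :=
      ((hasDerivAt_id y).const_mul 2).mul ((hasDerivAt_id y).add_const 2)
    have h4 := h1.sub (h2.div h3 (by positivity))
    refine h4.congr_deriv ?_
    field_simp
    ring
  have hG1 : G 1 = 0 := by simp [hG]
  have key : 0 ≤ G x := by
    rcases le_total 1 x with h | h
    · have hm : MonotoneOn G (Set.Ici 1) := by
        apply monotoneOn_of_deriv_nonneg (convex_Ici 1)
        · intro y hy
          exact (hd y (lt_of_lt_of_le one_pos hy)).continuousAt.continuousWithinAt
        · intro y hy
          rw [interior_Ici] at hy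
          exact (hd y (one_pos.trans hy)).differentiableAt.differentiableWithinAt
        · intro y hy
          rw [interior_Ici] at hy
          rw [(hd y (one_pos.trans hy)).deriv]
          have : 0 ≤ y - 1 := sub_nonneg.2 (le_of_lt hy)
          positivity
      have := hm (Set.mem_Ici.2 le_rfl) (Set.mem_Ici.2 h) h
      rwa [hG1] at this
    · have hm : AntitoneOn G (Set.Ioc 0 1) := by
        apply antitoneOn_of_deriv_nonpos (convex_Ioc 0 1)
        · intro y hy
          exact (hd y hy.1).continuousAt.continuousWithinAt
        · intro y hy
          rw [interior_Ioc] at hy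
          exact (hd y hy.1).differentiableAt.differentiableWithinAt
        · intro y hy
          rw [interior_Ioc] at hy
          rw [(hd y hy.1).deriv]
          have h0 : 0 ≤ 1 - y := sub_nonneg.2 hy.2.le
          have h3 : (y - 1) ^ 3 ≤ 0 := by
            have : 0 ≤ (1 - y) ^ 3 := by positivity
            nlinarith
          exact div_nonpos_of_nonpos_of_nonneg h3 (by positivity)
      have := hm ⟨hx, h⟩ ⟨one_pos, le_rfl⟩ h
      rwa [hG1] at this
  simp only [hG] at key
  linarith

theorem phi_lower (x : ℝ) (hx : 0 ≤ x) :
    (x - 1) ^ 2 ≤ ((4 + 2 * x) / 3) * (x * Real.log x - x + 1) := by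
  rcases hx.eq_or_lt with rfl | hx
  · norm_num
  · have h := log_lower x hx
    rw [div_le_iff₀ (by positivity)] at h
    nlinarith

/-- Pinsker's inequality in nats. -/
theorem pinsker_nat {Z : Type*} [Fintype Z] (p q : Z → ℝ) (hp : ∀ z, 0 ≤ p z)
    (hq : ∀ z, 0 < q z) (hps : ∑ z, p z = 1) (hqs : ∑ z, q z = 1) :
    (l1dist p q) ^ 2 ≤ 2 * ∑ z, p z * Real.log (p z / q z) := by
  have hpt : ∀ z, |p z - q z| ^ 2 ≤
      ((4 * q z + 2 * p z) / 3) * (p z * Real.log (p z / q z) - p z + q z) := by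
    intro z
    have h := phi_lower (p z / q z) (div_nonneg (hp z) (hq z).le)
    have hqz := hq z
    rw [sq_abs]
    have h2 := mul_le_mul_of_nonneg_left h (sq_nonneg (q z))
    have e1 : q z ^ 2 * (p z / q z - 1) ^ 2 = (p z - q z) ^ 2 := by
      field_simp
    have e2 : q z ^ 2 * ((4 + 2 * (p z / q z)) / 3 *
        (p z / q z * Real.log (p z / q z) - p z / q z + 1)) =
        ((4 * q z + 2 * p z) / 3) * (p z * Real.log (p z / q z) - p z + q z) := by
      generalize Real.log (p z / q z) = l
      field_simp
    rwa [e1, e2] at h2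
  have hf : ∀ z, 0 ≤ (4 * q z + 2 * p z) / 3 := fun z => by
    have := hq z; have := hp z; positivity
  have hg : ∀ z, 0 ≤ p z * Real.log (p z / q z) - p z + q z := fun z => by
    have h1 : 0 < (4 * q z + 2 * p z) / 3 := by
      have := hq z; have := hp z; positivity
    exact nonneg_of_mul_nonneg_right ((sq_nonneg _).trans (hpt z)) h1
  have cs := Finset.sum_sq_le_sum_mul_sum_of_sq_le_mul Finset.univ
    (r := fun z => |p z - q z|) (fun z _ => hf z) (fun z _ => hg z) (fun z _ => hpt z)
  have s1 : ∑ z, (4 * q z + 2 * p z) / 3 = 2 := by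
    rw [← Finset.sum_div, Finset.sum_add_distrib, ← Finset.mul_sum, ← Finset.mul_sum, hps, hqs]
    norm_num
  have s2 : ∑ z, (p z * Real.log (p z / q z) - p z + q z) = ∑ z, p z * Real.log (p z / q z) := by
    rw [Finset.sum_add_distrib, Finset.sum_sub_distrib, hps, hqs]
    ring
  rw [s1, s2] at cs
  exact cs

/-- Summation over the edges of the tree. -/
theorem sum_edges {Z : Type*} [Fintype Z] [DecidableEq Z] (L : Finset (List Z))
    (P : List Z → ℝ) (f : List Z → Z → ℝ) :
    ∑ t ∈ branchSet L, ∑ z, nodeProb L P (t ++ [z]) * f t z =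
      ∑ s ∈ L, P s * ∑ i : Fin s.length, f (s.take i) s[i] := by
  have h1 : ∀ t z, nodeProb L P (t ++ [z]) * f t z =
      ∑ s ∈ L, if (t ++ [z]) <+: s then P s * f t z else 0 := by
    intro t z
    rw [nodeProb, Finset.sum_mul, Finset.sum_filter]
  simp_rw [h1]
  rw [← Finset.sum_product', Finset.sum_comm]
  refine Finset.sum_congr rfl fun s hs => ?_
  rw [← Finset.sum_filter, Finset.mul_sum]
  symm
  refine Finset.sum_bij (fun i _ => (s.take i, s[i])) ?_ ?_ ?_ ?_
  · intro i _
    simp only [Finset.mem_filter, Finset.mem_product, Finset.mem_univ, and_true]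
    refine ⟨?_, ?_⟩
    · simp only [branchSet, Finset.mem_biUnion, Finset.mem_image, Finset.mem_range]
      exact ⟨s, hs, i, i.2, rfl⟩
    · have : s.take i ++ [s[i]] = s.take (i + 1) := by simp
      rw [this]
      exact List.take_prefix _ _
  · intro i _ j _ h
    have h1 := congrArg (fun p => p.1.length) h
    simp only [List.length_take] at h1
    ext
    omega
  · rintro ⟨t, z⟩ h
    simp only [Finset.mem_filter] at h
    obtain ⟨r, hr⟩ := h.2
    subst hr
    refine ⟨⟨t.length, by simp⟩, Finset.mem_univ _, ?_⟩
    simp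
  · intro i _
    rfl

theorem nodeProb_nonneg' {Z : Type*} [DecidableEq Z] (L : Finset (List Z))
    (P : List Z → ℝ) (hPnn : ∀ t ∈ L, 0 ≤ P t) (t : List Z) : 0 ≤ nodeProb L P t :=
  Finset.sum_nonneg fun s hs => hPnn s (Finset.mem_filter.1 hs).1

theorem nodeProb_children {Z : Type*} [Fintype Z] [DecidableEq Z] (L : Finset (List Z))
    (P : List Z → ℝ) (t : List Z) (ht : t ∉ L) :
    ∑ z, nodeProb L P (t ++ [z]) = nodeProb L P t := by
  simp only [nodeProb, Finset.sum_filter]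
  rw [Finset.sum_comm]
  refine Finset.sum_congr rfl fun s hs => ?_
  by_cases h : t <+: s
  · obtain ⟨r, rfl⟩ := h
    cases r with
    | nil => simp at hs; exact absurd hs ht
    | cons a r =>
      simp [List.prefix_append_right_inj]
  · rw [if_neg h]
    refine Finset.sum_eq_zero fun z _ => ?_
    rw [if_neg]
    exact fun h' => h ((List.prefix_append _ _).trans h')

theorem branch_notMem {Z : Type*} [DecidableEq Z] (L : Finset (List Z))
    (hL : IsCompleteLeafSet L) (t : List Z) (ht : t ∈ branchSet L) : t ∉ L := by
  intro h
  simp only [branchSet, Finset.mem_biUnion, Finset.mem_image, Finset.mem_range] at ht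
  obtain ⟨s, hs, i, hi, rfl⟩ := ht
  have := congrArg List.length (hL.2.1 _ h s hs (List.take_prefix _ _))
  simp at this
  omega

theorem leaf_telescope {Z : Type*} [DecidableEq Z] (L : Finset (List Z))
    (hL : IsCompleteLeafSet L) (PZ : Z → ℝ) (hZpos : ∀ z : Z, 0 < PZ z)
    (P : List Z → ℝ) (hPnn : ∀ t ∈ L, 0 ≤ P t) (hPsum : ∑ t ∈ L, P t = 1)
    (s : List Z) (hs : s ∈ L) :
    P s * ∑ i : Fin s.length, Real.log (branchDist L P (s.take i) s[i] / PZ s[i]) =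
      P s * Real.log (P s / inducedProb PZ s) := by
  rcases (hPnn s hs).eq_or_lt with h0 | hpos
  · simp [← h0]
  congr 1
  have hQ : ∀ i, 0 < nodeProb L P (s.take i) := fun i =>
    hpos.trans_le (Finset.single_le_sum (f := P)
      (fun u hu => hPnn u (Finset.mem_filter.1 hu).1)
      (Finset.mem_filter.2 ⟨hs, List.take_prefix _ _⟩))
  have hQs : nodeProb L P s = P s := by
    have : L.filter (fun u => s <+: u) = {s} := by
      ext u
      simp only [Finset.mem_filter, Finset.mem_singleton]
      constructor
      · rintro ⟨hu, h⟩
        exact (hL.2.1 s hs u hu h).symm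
      · rintro rfl
        exact ⟨hs, List.prefix_rfl⟩
    rw [nodeProb, this, Finset.sum_singleton]
  have hQ0 : nodeProb L P [] = 1 := by
    simp [nodeProb, hPsum]
  have hterm : ∀ i : Fin s.length,
      Real.log (branchDist L P (s.take i) s[i] / PZ s[i]) =
      (Real.log (nodeProb L P (s.take (i + 1))) - Real.log (nodeProb L P (s.take i)))
        - Real.log (PZ s[i]) := by
    intro i
    have e : s.take i ++ [s[i]] = s.take (i + 1) := by simp
    rw [branchDist, e, Real.log_div (div_pos (hQ _) (hQ _)).ne' (hZpos _).ne',
      Real.log_div (hQ _).ne' (hQ _).ne']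
  have hind : inducedProb PZ s = ∏ i : Fin s.length, PZ s[i] := by
    rw [inducedProb]
    exact (Fin.prod_univ_fun_getElem s PZ).symm
  rw [Finset.sum_congr rfl fun i _ => hterm i, Finset.sum_sub_distrib,
    Fin.sum_univ_eq_sum_range (fun i => Real.log (nodeProb L P (s.take (i + 1))) -
      Real.log (nodeProb L P (s.take i))),
    Finset.sum_range_sub (fun i => Real.log (nodeProb L P (s.take i))), hind,
    Real.log_div hpos.ne' (Finset.prod_pos fun i _ => hZpos _).ne',
    Real.log_prod (fun i _ => (hZpos _).ne')]
  simp [hQ0, hQs]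

/-- **Normalized Pinsker's Inequality.**
`D(P_Y ‖ P_Z^L)/E[ℓ(Y)] ≥ (1/(2 ln 2)) Σ_{t ∈ B} P_B(t) ‖P_{Y_t} − P_Z‖₁²`
`≥ (1/(2 ln 2)) (Σ_{t ∈ B} P_B(t) ‖P_{Y_t} − P_Z‖₁)²`,
where `P_B(t) = Q(t)/E[ℓ(Y)]` and terms with `Q(t) = 0` are taken to be `0`. -/
theorem normalized_pinsker {Z : Type*} [Fintype Z] [DecidableEq Z]
    (L : Finset (List Z)) (hL : IsCompleteLeafSet L)
    (hZ : 2 ≤ Fintype.card Z)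
    (PZ : Z → ℝ) (hZpos : ∀ z : Z, 0 < PZ z) (hZsum : ∑ z : Z, PZ z = 1)
    (P : List Z → ℝ) (hPnn : ∀ t ∈ L, 0 ≤ P t) (hPsum : ∑ t ∈ L, P t = 1) :
    (1 / (2 * Real.log 2)) *
        (∑ t ∈ branchSet L, (nodeProb L P t / expLen L P) *
          (l1dist (branchDist L P t) PZ) ^ 2) ≤
      kl L P (inducedProb PZ) / expLen L P ∧
    (1 / (2 * Real.log 2)) *
        (∑ t ∈ branchSet L, (nodeProb L P t / expLen L P) *
          l1dist (branchDist L P t) PZ) ^ 2 ≤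
      (1 / (2 * Real.log 2)) *
        (∑ t ∈ branchSet L, (nodeProb L P t / expLen L P) *
          (l1dist (branchDist L P t) PZ) ^ 2) := by
  have hlog2 : 0 < Real.log 2 := Real.log_pos (by norm_num)
  have hQnn := nodeProb_nonneg' L P hPnn
  have hE : ∑ t ∈ branchSet L, nodeProb L P t = expLen L P := by
    have h := sum_edges L P (fun _ _ => 1)
    simp only [mul_one, Finset.sum_const, Finset.card_univ, Fintype.card_fin,
      nsmul_eq_mul] at h
    rw [expLen, ← h]
    exact Finset.sum_congr rfl fun t ht =>
      (nodeProb_children L P t (branch_notMem L hL t ht)).symm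
  have hEpos : 0 < expLen L P := by
    have : ∑ t ∈ L, P t ≤ expLen L P := by
      refine Finset.sum_le_sum fun t ht => ?_
      have h1 : (1 : ℝ) ≤ t.length := by
        exact_mod_cast List.length_pos_iff.2 (hL.1 t ht)
      nlinarith [hPnn t ht]
    linarith
  constructor
  · have hkl : kl L P (inducedProb PZ) * Real.log 2 =
        ∑ t ∈ branchSet L, ∑ z, nodeProb L P (t ++ [z]) *
          Real.log (branchDist L P t z / PZ z) := by
      rw [sum_edges L P (fun t z => Real.log (branchDist L P t z / PZ z)), kl, Finset.sum_mul]
      refine Finset.sum_congr rfl fun s hs => ?_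
      rw [leaf_telescope L hL PZ hZpos P hPnn hPsum s hs, Real.logb]
      field_simp
    have hmain : ∑ t ∈ branchSet L, nodeProb L P t * (l1dist (branchDist L P t) PZ) ^ 2 ≤
        2 * (kl L P (inducedProb PZ) * Real.log 2) := by
      rw [hkl, Finset.mul_sum]
      refine Finset.sum_le_sum fun t ht => ?_
      have hch := nodeProb_children L P t (branch_notMem L hL t ht)
      rcases (hQnn t).eq_or_lt with h0 | hpos
      · have hz : ∀ z, nodeProb L P (t ++ [z]) = 0 := by
          rw [← h0, Finset.sum_eq_zero_iff_of_nonneg (fun z _ => hQnn _)] at hch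
          exact fun z => hch z (Finset.mem_univ z)
        simp [← h0, hz]
      · have hp := pinsker_nat (branchDist L P t) PZ
          (fun z => div_nonneg (hQnn _) (hQnn _)) hZpos
          (by simp only [branchDist]; rw [← Finset.sum_div, hch, div_self hpos.ne']) hZsum
        have e : ∀ z, nodeProb L P (t ++ [z]) = nodeProb L P t * branchDist L P t z := by
          intro z
          rw [branchDist]
          field_simp
        have := mul_le_mul_of_nonneg_left hp hpos.le
        refine this.trans (le_of_eq ?_)
        rw [mul_left_comm, Finset.mul_sum]
        congr 1
        refine Finset.sum_congr rfl fun z _ => ?_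
        rw [e z, mul_assoc]
    have e1 : ∑ t ∈ branchSet L, (nodeProb L P t / expLen L P) *
          (l1dist (branchDist L P t) PZ) ^ 2 =
        (∑ t ∈ branchSet L, nodeProb L P t * (l1dist (branchDist L P t) PZ) ^ 2)
          / expLen L P := by
      rw [Finset.sum_div]
      exact Finset.sum_congr rfl fun t _ => by ring
    rw [e1, ← mul_div_assoc]
    refine div_le_div_of_nonneg_right ?_ hEpos.le
    rw [one_div, inv_mul_le_iff₀ (by positivity)]
    linarith
  · refine mul_le_mul_of_nonneg_left ?_ (by positivity)
    have cs := Finset.sum_sq_le_sum_mul_sum_of_sq_le_mul (branchSet L)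
      (r := fun t => (nodeProb L P t / expLen L P) * l1dist (branchDist L P t) PZ)
      (f := fun t => nodeProb L P t / expLen L P)
      (g := fun t => (nodeProb L P t / expLen L P) * (l1dist (branchDist L P t) PZ) ^ 2)
      (fun t _ => div_nonneg (hQnn t) hEpos.le)
      (fun t _ => mul_nonneg (div_nonneg (hQnn t) hEpos.le) (sq_nonneg _))
      (fun t _ => le_of_eq (by ring))
    rwa [← Finset.sum_div, hE, div_self hEpos.ne', one_mul] at cs
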